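/- Let x : U → ℝ³ be a wavefront, Ω a tmb of x, and p ∈ Σ(x) with rank(Dx(p)) = 1. Then one of the principal curvature functions κ₋ := H − √(H² − K), κ₊ := H + √(H² − K), defined on Σ(x)ᶜ, admits a C^∞ extension to an open neighborhood of p if and only if x is parallelly smoothable at p. -/

import Mathlib

/- Common framework for frontals and tangent moving bases, following
   "Curvatures on fronts" conventions. -/

noncomputable section

open Matrix Topology Filter

/-- Points of the plane ℝ². -/
abbrev Pt : Type := Fin 2 → ℝ

/-- Jacobian matrix of a map `f : ℝ² → ℝ^m` at a point. -/
def jac {m : ℕ} (f : Pt → (Fin m → ℝ)) (p : Pt) : Matrix (Fin m) (Fin 2) ℝ :=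
  Matrix.of fun i j => fderiv ℝ f p (Pi.single j 1) i

/-- Euclidean norm of a vector in ℝ³. -/
def enorm3 (v : Fin 3 → ℝ) : ℝ := Real.sqrt (v ⬝ᵥ v)

/-- The unit normal vector field induced by a tangent moving base `Ω`,
    `n := (w₁ × w₂)/‖w₁ × w₂‖` where `w₁, w₂` are the columns of `Ω`. -/
def normalOf (Ω : Pt → Matrix (Fin 3) (Fin 2) ℝ) (p : Pt) : Fin 3 → ℝ :=
  (enorm3 (crossProduct (fun i => Ω p i 0) (fun i => Ω p i 1)))⁻¹ •
    crossProduct (fun i => Ω p i 0) (fun i => Ω p i 1)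

/-- First fundamental form matrix of a map `y`. -/
def IOf (y : Pt → Fin 3 → ℝ) (p : Pt) : Matrix (Fin 2) (Fin 2) ℝ :=
  (jac y p)ᵀ * jac y p

/-- Second fundamental form matrix of a map `y` with respect to a unit normal `ν`. -/
def IIOf (y ν : Pt → Fin 3 → ℝ) (p : Pt) : Matrix (Fin 2) (Fin 2) ℝ :=
  -((jac y p)ᵀ * jac ν p)

/-- Weingarten matrix `α := −IIᵀ I⁻¹` of a map `y` with unit normal `ν`. -/
def weinOf (y ν : Pt → Fin 3 → ℝ) (p : Pt) : Matrix (Fin 2) (Fin 2) ℝ :=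
  -((IIOf y ν p)ᵀ * (IOf y p)⁻¹)

/-- Gaussian curvature of an immersion `y` with unit normal `ν`. -/
def KgOf (y ν : Pt → Fin 3 → ℝ) (p : Pt) : ℝ :=
  (IIOf y ν p).det / (IOf y p).det

/-- Mean curvature of an immersion `y` with unit normal `ν`. -/
def HmOf (y ν : Pt → Fin 3 → ℝ) (p : Pt) : ℝ :=
  -(1 / 2) * (weinOf y ν p).trace

/-- Smaller principal curvature `H − √(H² − K)` of an immersion `y`. -/
def k1Of (y ν : Pt → Fin 3 → ℝ) (p : Pt) : ℝ :=
  HmOf y ν p - Real.sqrt ((HmOf y ν p) ^ 2 - KgOf y ν p)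

/-- Larger principal curvature `H + √(H² − K)` of an immersion `y`. -/
def k2Of (y ν : Pt → Fin 3 → ℝ) (p : Pt) : ℝ :=
  HmOf y ν p + Real.sqrt ((HmOf y ν p) ^ 2 - KgOf y ν p)

/-- A frontal `x : U → ℝ³` equipped with a tangent moving base (tmb) `Ω` and the
induced smooth matrix-valued maps `Λ`, `μ` satisfying `Dx = Ω Λᵀ` and `Dn = Ω μᵀ` on `U`. -/
structure Frontal where
  /-- the domain -/
  U : Set Pt
  isOpen_U : IsOpen U
  /-- the frontal -/
  x : Pt → Fin 3 → ℝ
  /-- the tangent moving base -/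
  Ω : Pt → Matrix (Fin 3) (Fin 2) ℝ
  /-- `Λ` with `Dx = Ω Λᵀ` -/
  Λ : Pt → Matrix (Fin 2) (Fin 2) ℝ
  /-- `μ` with `Dn = Ω μᵀ` -/
  μ : Pt → Matrix (Fin 2) (Fin 2) ℝ
  smooth_x : ContDiffOn ℝ (⊤ : ℕ∞) x U
  smooth_Ω : ∀ i j, ContDiffOn ℝ (⊤ : ℕ∞) (fun p => Ω p i j) U
  smooth_Λ : ∀ i j, ContDiffOn ℝ (⊤ : ℕ∞) (fun p => Λ p i j) U
  smooth_μ : ∀ i j, ContDiffOn ℝ (⊤ : ℕ∞) (fun p => μ p i j) U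
  /-- the columns of `Ω` are linearly independent (nonzero cross product) -/
  indep : ∀ p ∈ U, crossProduct (fun i => Ω p i 0) (fun i => Ω p i 1) ≠ 0
  decomp_x : ∀ p ∈ U, jac x p = Ω p * (Λ p)ᵀ
  decomp_n : ∀ p ∈ U, jac (normalOf Ω) p = Ω p * (μ p)ᵀ

namespace Frontal

variable (F : Frontal)

/-- The unit normal induced by the tmb. -/
def n : Pt → Fin 3 → ℝ := normalOf F.Ω

/-- `λ_Ω := det Λ`. -/
def lam (p : Pt) : ℝ := (F.Λ p).det

/-- The Ω-relative curvature `K_Ω := det μ`. -/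
def KΩ (p : Pt) : ℝ := (F.μ p).det

/-- `α_Ω := μ · adj(Λ)`. -/
def αΩ (p : Pt) : Matrix (Fin 2) (Fin 2) ℝ := F.μ p * (F.Λ p).adjugate

/-- The Ω-relative mean curvature `H_Ω := −(1/2) tr α_Ω`. -/
def HΩ (p : Pt) : ℝ := -(1 / 2) * (F.αΩ p).trace

/-- The relative principal curvature `k_{1Ω} := H_Ω − √(H_Ω² − λ_Ω K_Ω)`. -/
def k1Ω (p : Pt) : ℝ := F.HΩ p - Real.sqrt ((F.HΩ p) ^ 2 - F.lam p * F.KΩ p)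

/-- The relative principal curvature `k_{2Ω} := H_Ω + √(H_Ω² − λ_Ω K_Ω)`. -/
def k2Ω (p : Pt) : ℝ := F.HΩ p + Real.sqrt ((F.HΩ p) ^ 2 - F.lam p * F.KΩ p)

/-- The singular set `Σ(x) = λ_Ω⁻¹(0)`. -/
def sing : Set Pt := {p ∈ F.U | F.lam p = 0}

/-- The regular set `U − Σ(x)`. -/
def reg : Set Pt := {p ∈ F.U | F.lam p ≠ 0}

/-- A frontal is proper if its singular set has empty interior. -/
def IsProper : Prop := interior F.sing = ∅

/-- `x` is a wavefront if `(x, n) : U → ℝ³ × S²` is an immersion. -/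
def IsWavefront : Prop :=
  ∀ p ∈ F.U, (Matrix.fromRows (jac F.x p) (jac F.n p)).rank = 2

/-- First fundamental form matrix `I = Dxᵀ Dx`. -/
def Imat (p : Pt) : Matrix (Fin 2) (Fin 2) ℝ := IOf F.x p

/-- Second fundamental form matrix `II = −Dxᵀ Dn`. -/
def IImat (p : Pt) : Matrix (Fin 2) (Fin 2) ℝ := IIOf F.x F.n p

/-- Weingarten matrix `α := −IIᵀ I⁻¹` (meaningful off the singular set). -/
def Wein (p : Pt) : Matrix (Fin 2) (Fin 2) ℝ := weinOf F.x F.n p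

/-- Coefficient `e` of the second fundamental form. -/
def e (p : Pt) : ℝ := F.IImat p 0 0

/-- Coefficient `f` of the second fundamental form. -/
def f (p : Pt) : ℝ := F.IImat p 0 1

/-- Coefficient `g` of the second fundamental form. -/
def g (p : Pt) : ℝ := F.IImat p 1 1

/-- Gaussian curvature (meaningful off the singular set). -/
def Kg (p : Pt) : ℝ := KgOf F.x F.n p

/-- Mean curvature (meaningful off the singular set). -/
def Hm (p : Pt) : ℝ := HmOf F.x F.n p

/-- Principal curvature `κ₋ := H − √(H² − K)`. -/
def κm (p : Pt) : ℝ := F.Hm p - Real.sqrt ((F.Hm p) ^ 2 - F.Kg p)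

/-- Principal curvature `κ₊ := H + √(H² − K)`. -/
def κp (p : Pt) : ℝ := F.Hm p + Real.sqrt ((F.Hm p) ^ 2 - F.Kg p)

/-- `k₁ := κ₋` where `λ_Ω > 0` and `k₁ := κ₊` where `λ_Ω < 0`. -/
def k1 (p : Pt) : ℝ := if 0 < F.lam p then F.κm p else F.κp p

/-- `k₂ := κ₊` where `λ_Ω > 0` and `k₂ := κ₋` where `λ_Ω < 0`. -/
def k2 (p : Pt) : ℝ := if 0 < F.lam p then F.κp p else F.κm p

/-- `x` is parallelly smoothable at `p` : for some `ε > 0` and some open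
neighborhood `V` of `p`, `rank D(x + l·n)(q) = 2` for all `(q,l) ∈ V × (0,ε)`
or for all `(q,l) ∈ V × (−ε,0)`. -/
def ParSmoothable (p : Pt) : Prop :=
  ∃ ε > (0 : ℝ), ∃ V : Set Pt, IsOpen V ∧ p ∈ V ∧ V ⊆ F.U ∧
    ((∀ q ∈ V, ∀ l ∈ Set.Ioo (0 : ℝ) ε,
        (jac (fun z => F.x z + l • F.n z) q).rank = 2) ∨
     (∀ q ∈ V, ∀ l ∈ Set.Ioo (-ε) (0 : ℝ),
        (jac (fun z => F.x z + l • F.n z) q).rank = 2))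

/-- `f` (defined off the singular set) has a `C^∞` extension to `V`. -/
def SmoothExtOn (f : Pt → ℝ) (V : Set Pt) : Prop :=
  ∃ g : Pt → ℝ, ContDiffOn ℝ (⊤ : ℕ∞) g V ∧ ∀ q ∈ V ∩ F.reg, g q = f q

/-- `f` has a `C^∞` extension to some open neighborhood of `p`. -/
def SmoothExtNear (f : Pt → ℝ) (p : Pt) : Prop :=
  ∃ V : Set Pt, IsOpen V ∧ p ∈ V ∧ V ⊆ F.U ∧ F.SmoothExtOn f V

/-- Membership in the principal ideal `𝔗_Ω(V)` generated by `λ_Ω` in `C^∞(V,ℝ)`. -/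
def memIdeal (f : Pt → ℝ) (V : Set Pt) : Prop :=
  ∃ φ : Pt → ℝ, ContDiffOn ℝ (⊤ : ℕ∞) φ V ∧ ∀ q ∈ V, f q = φ q * F.lam q

end Frontal

/-- `f` does not change sign on `V`. -/
def NoSignChange (f : Pt → ℝ) (V : Set Pt) : Prop :=
  (∀ q ∈ V, 0 ≤ f q) ∨ (∀ q ∈ V, f q ≤ 0)

section RelativeRoots

variable {U : Set Pt} {l H K : Pt → ℝ} {p : Pt}

/-- The small root of `l - 2 t H + t² K` as a function of `t`. -/
lemma small_root {l H K s : ℝ} (hs : s ^ 2 = H ^ 2 - l * K) (h : H + s ≠ 0) :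
    l - 2 * (l / (H + s)) * H + (l / (H + s)) ^ 2 * K = 0 := by
  field_simp
  linear_combination l * hs

lemma mul_sub_sqrt_ge {l H K : ℝ} (hl : l < 0) :
    H ≤ l * (H / l - Real.sqrt ((H / l) ^ 2 - K / l)) := by
  have h1 : l * (H / l) = H := mul_div_cancel₀ H hl.ne
  have h2 := Real.sqrt_nonneg ((H / l) ^ 2 - K / l)
  nlinarith

lemma mul_add_sqrt_ge {l H K : ℝ} (hl : 0 < l) :
    H ≤ l * (H / l + Real.sqrt ((H / l) ^ 2 - K / l)) := by
  have h1 : l * (H / l) = H := mul_div_cancel₀ H hl.ne'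
  have h2 := Real.sqrt_nonneg ((H / l) ^ 2 - K / l)
  nlinarith

lemma sqrt_div_eq {l H K : ℝ} (hl : l ≠ 0) :
    Real.sqrt ((H / l) ^ 2 - K / l) = Real.sqrt (H ^ 2 - l * K) / |l| := by
  rw [← Real.sqrt_sq_eq_abs, ← Real.sqrt_div' _ (sq_nonneg l)]
  congr 1
  field_simp

lemma sub_sqrt_eq {l H K : ℝ} (hl : 0 < l) (hH : 0 < H) (hD : 0 < H ^ 2 - l * K) :
    K / (H + Real.sqrt (H ^ 2 - l * K)) = H / l - Real.sqrt ((H / l) ^ 2 - K / l) := by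
  rw [sqrt_div_eq hl.ne', abs_of_pos hl]
  have h1 := Real.sq_sqrt hD.le
  have h2 := Real.sqrt_nonneg (H ^ 2 - l * K)
  generalize Real.sqrt (H ^ 2 - l * K) = s at h1 h2 ⊢
  have : H + s ≠ 0 := by positivity
  field_simp
  linear_combination h1

lemma add_sqrt_eq {l H K : ℝ} (hl : l < 0) (hH : 0 < H) (hD : 0 < H ^ 2 - l * K) :
    K / (H + Real.sqrt (H ^ 2 - l * K)) = H / l + Real.sqrt ((H / l) ^ 2 - K / l) := by
  rw [sqrt_div_eq hl.ne, abs_of_neg hl]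
  have h1 := Real.sq_sqrt hD.le
  have h2 := Real.sqrt_nonneg (H ^ 2 - l * K)
  generalize Real.sqrt (H ^ 2 - l * K) = s at h1 h2 ⊢
  have : H + s ≠ 0 := by positivity
  have hl' := hl.ne
  field_simp
  linear_combination h1

/-- If `κ` has a continuous extension at a zero `p` of `l`, then `l κ` cannot stay above `H`
at points of `P` accumulating at `p`. -/
lemma eventually_not_of_extension {κ g : Pt → ℝ} {P : Pt → Prop}
    (hl : ContinuousAt l p) (hH : ContinuousAt H p) (hlp : l p = 0) (hHp : 0 < H p)
    (hg : ContinuousAt g p) (hκ : ∀ᶠ q in 𝓝 p, P q → g q = κ q)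
    (hP : ∀ q, P q → H q ≤ l q * κ q) : ∀ᶠ q in 𝓝 p, ¬ P q := by
  have hc : ContinuousAt (fun q => H q - l q * g q) p := hH.sub (hl.mul hg)
  have : ∀ᶠ q in 𝓝 p, 0 < H q - l q * g q :=
    hc.eventually_const_lt (by simpa [hlp] using hHp)
  filter_upwards [this, hκ] with q h1 h2 h3
  have := hP q h3
  rw [h2 h3] at h1
  linarith

lemma eventually_discr_pos (hl : ContinuousAt l p) (hH : ContinuousAt H p)
    (hK : ContinuousAt K p) (hlp : l p = 0) (hHp : 0 < H p) :
    ∀ᶠ q in 𝓝 p, 0 < H q ^ 2 - l q * K q := by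
  have hc : ContinuousAt (fun q => H q ^ 2 - l q * K q) p := (hH.pow 2).sub (hl.mul hK)
  exact hc.eventually_const_lt (by simpa [hlp] using pow_pos hHp 2)

lemma exists_extension_iff_of_pos (hU : IsOpen U) (hl : ContDiffOn ℝ (⊤ : ℕ∞) l U)
    (hH : ContDiffOn ℝ (⊤ : ℕ∞) H U) (hK : ContDiffOn ℝ (⊤ : ℕ∞) K U)
    (hp : p ∈ U) (hlp : l p = 0) (hHp : 0 < H p) :
    ((∃ V : Set Pt, IsOpen V ∧ p ∈ V ∧ V ⊆ U ∧ ∃ g : Pt → ℝ, ContDiffOn ℝ (⊤ : ℕ∞) g V ∧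
        ∀ q ∈ V, l q ≠ 0 → g q = H q / l q - Real.sqrt ((H q / l q) ^ 2 - K q / l q)) ∨
     (∃ V : Set Pt, IsOpen V ∧ p ∈ V ∧ V ⊆ U ∧ ∃ g : Pt → ℝ, ContDiffOn ℝ (⊤ : ℕ∞) g V ∧
        ∀ q ∈ V, l q ≠ 0 → g q = H q / l q + Real.sqrt ((H q / l q) ^ 2 - K q / l q))) ↔
    ((∀ᶠ q in 𝓝 p, 0 ≤ l q) ∨ (∀ᶠ q in 𝓝 p, l q ≤ 0)) := by
  have hUp := hU.mem_nhds hp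
  have hlc := hl.continuousOn.continuousAt hUp
  have hHc := hH.continuousOn.continuousAt hUp
  have hKc := hK.continuousOn.continuousAt hUp
  constructor
  · rintro (⟨V, hV, hpV, -, g, hg, hgq⟩ | ⟨V, hV, hpV, -, g, hg, hgq⟩)
    · left
      have := eventually_not_of_extension (P := fun q => l q < 0) hlc hHc hlp hHp
        (hg.continuousOn.continuousAt (hV.mem_nhds hpV))
        (by filter_upwards [hV.mem_nhds hpV] with q hq h using hgq q hq h.ne)
        (fun q hq => mul_sub_sqrt_ge hq)
      simpa using this
    · right
      have := eventually_not_of_extension (P := fun q => 0 < l q) hlc hHc hlp hHp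
        (hg.continuousOn.continuousAt (hV.mem_nhds hpV))
        (by filter_upwards [hV.mem_nhds hpV] with q hq h using hgq q hq h.ne')
        (fun q hq => mul_add_sqrt_ge hq)
      simpa using this
  · have key : ∀ P : Pt → Prop, (∀ᶠ q in 𝓝 p, P q) → ∃ V : Set Pt, IsOpen V ∧ p ∈ V ∧ V ⊆ U ∧
        (∀ q ∈ V, P q ∧ 0 < H q ∧ 0 < H q ^ 2 - l q * K q) ∧
        ContDiffOn ℝ (⊤ : ℕ∞) (fun q => K q / (H q + Real.sqrt (H q ^ 2 - l q * K q))) V := by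
      intro P hP
      obtain ⟨V, hVs, hV, hpV⟩ := eventually_nhds_iff.1 (hP.and ((hHc.eventually_const_lt hHp).and
        ((eventually_discr_pos hlc hHc hKc hlp hHp).and hUp)))
      refine ⟨V, hV, hpV, fun q hq => (hVs q hq).2.2.2,
        fun q hq => ⟨(hVs q hq).1, (hVs q hq).2.1, (hVs q hq).2.2.1⟩, ?_⟩
      have hVU : V ⊆ U := fun q hq => (hVs q hq).2.2.2
      refine (hK.mono hVU).div ((hH.mono hVU).add (((((hH.mono hVU).pow 2)).sub
        ((hl.mono hVU).mul (hK.mono hVU))).sqrt fun q hq => (hVs q hq).2.2.1.ne')) fun q hq => ?_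
      have := (hVs q hq).2.1
      positivity
    rintro (h | h)
    · left
      obtain ⟨V, hV, hpV, hVU, hVs, hg⟩ := key _ h
      exact ⟨V, hV, hpV, hVU, _, hg, fun q hq hne =>
        sub_sqrt_eq ((hVs q hq).1.lt_of_ne' hne) (hVs q hq).2.1 (hVs q hq).2.2⟩
    · right
      obtain ⟨V, hV, hpV, hVU, hVs, hg⟩ := key _ h
      exact ⟨V, hV, hpV, hVU, _, hg, fun q hq hne =>
        add_sqrt_eq ((hVs q hq).1.lt_of_ne hne) (hVs q hq).2.1 (hVs q hq).2.2⟩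

lemma exists_no_root_iff_of_pos (hU : IsOpen U) (hl : ContinuousOn l U)
    (hH : ContinuousOn H U) (hK : ContinuousOn K U)
    (hp : p ∈ U) (hlp : l p = 0) (hHp : 0 < H p) :
    (∃ ε > (0 : ℝ), ∃ V : Set Pt, IsOpen V ∧ p ∈ V ∧ V ⊆ U ∧
      ((∀ q ∈ V, ∀ t ∈ Set.Ioo (0 : ℝ) ε, l q - 2 * t * H q + t ^ 2 * K q ≠ 0) ∨
       (∀ q ∈ V, ∀ t ∈ Set.Ioo (-ε) (0 : ℝ), l q - 2 * t * H q + t ^ 2 * K q ≠ 0))) ↔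
    ((∀ᶠ q in 𝓝 p, 0 ≤ l q) ∨ (∀ᶠ q in 𝓝 p, l q ≤ 0)) := by
  have hUp := hU.mem_nhds hp
  have hlc := hl.continuousAt hUp
  have hHc := hH.continuousAt hUp
  have hKc := hK.continuousAt hUp
  constructor
  · rintro ⟨ε, hε, V, hV, hpV, -, h⟩
    have hD := eventually_discr_pos hlc hHc hKc hlp hHp
    have hpos : H p + Real.sqrt (H p ^ 2 - l p * K p) ≠ 0 := by positivity
    have hroot : ContinuousAt (fun q => l q / (H q + Real.sqrt (H q ^ 2 - l q * K q))) p :=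
      hlc.div (hHc.add ((hHc.pow 2).sub (hlc.mul hKc)).sqrt) hpos
    have hlt := hroot.eventually_lt_const (u := ε) (by simpa [hlp] using hε)
    have hgt := hroot.eventually_const_lt (u := -ε) (by simpa [hlp] using hε)
    rcases h with h | h
    · right
      filter_upwards [hD, hlt, hV.mem_nhds hpV, hHc.eventually_const_lt hHp] with q h1 h2 h3 h4
      by_contra! hq
      exact h q h3 _ ⟨by positivity, h2⟩ (small_root (Real.sq_sqrt h1.le) (by positivity))
    · left
      filter_upwards [hD, hgt, hV.mem_nhds hpV, hHc.eventually_const_lt hHp] with q h1 h2 h3 h4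
      by_contra! hq
      exact h q h3 _ ⟨h2, div_neg_of_neg_of_pos hq (by positivity)⟩
        (small_root (Real.sq_sqrt h1.le) (by positivity))
  · intro h
    have hMpos : 0 < |K p| + 1 := by positivity
    have hKM : ∀ᶠ q in 𝓝 p, |K q| < |K p| + 1 := hKc.abs.eventually_lt_const (by linarith)
    have hHM : ∀ᶠ q in 𝓝 p, H p / 2 < H q := hHc.eventually_const_lt (by linarith)
    have hlin : ∀ q t, |K q| < |K p| + 1 → H p / 2 < H q → |t| < H p / (|K p| + 1) →
        0 < 2 * H q - t * K q := by
      intro q t h1 h2 h3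
      have h4 : |t * K q| < H p := by
        rw [abs_mul]
        calc |t| * |K q| ≤ |t| * (|K p| + 1) := by gcongr
          _ < H p := (lt_div_iff₀ hMpos).1 h3
      linarith [le_abs_self (t * K q)]
    refine ⟨H p / (|K p| + 1), by positivity, ?_⟩
    rcases h with h | h
    · obtain ⟨V, hVs, hV, hpV⟩ := eventually_nhds_iff.1 (h.and (hKM.and (hHM.and hUp)))
      refine ⟨V, hV, hpV, fun q hq => (hVs q hq).2.2.2, Or.inr fun q hq t ht => ?_⟩
      obtain ⟨h1, h2, h3, -⟩ := hVs q hq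
      have := hlin q t h2 h3 (abs_lt.2 ⟨ht.1, ht.2.trans (by positivity)⟩)
      nlinarith [mul_pos_of_neg_of_neg ht.2 (neg_neg_of_pos this)]
    · obtain ⟨V, hVs, hV, hpV⟩ := eventually_nhds_iff.1 (h.and (hKM.and (hHM.and hUp)))
      refine ⟨V, hV, hpV, fun q hq => (hVs q hq).2.2.2, Or.inl fun q hq t ht => ?_⟩
      obtain ⟨h1, h2, h3, -⟩ := hVs q hq
      have := hlin q t h2 h3 (abs_lt.2 ⟨lt_trans (neg_neg_of_pos (by positivity)) ht.1, ht.2⟩)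
      nlinarith [mul_pos ht.1 this]

/-- A branch of `H / l ∓ √((H / l)² - K / l)` extends smoothly across a zero of `l` exactly when
`l - 2 t H + t² K` has no small roots `t` of one sign. -/
lemma exists_extension_iff_exists_no_root (hU : IsOpen U) (hl : ContDiffOn ℝ (⊤ : ℕ∞) l U)
    (hH : ContDiffOn ℝ (⊤ : ℕ∞) H U) (hK : ContDiffOn ℝ (⊤ : ℕ∞) K U)
    (hp : p ∈ U) (hlp : l p = 0) (hHp : H p ≠ 0) :
    ((∃ V : Set Pt, IsOpen V ∧ p ∈ V ∧ V ⊆ U ∧ ∃ g : Pt → ℝ, ContDiffOn ℝ (⊤ : ℕ∞) g V ∧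
        ∀ q ∈ V, l q ≠ 0 → g q = H q / l q - Real.sqrt ((H q / l q) ^ 2 - K q / l q)) ∨
     (∃ V : Set Pt, IsOpen V ∧ p ∈ V ∧ V ⊆ U ∧ ∃ g : Pt → ℝ, ContDiffOn ℝ (⊤ : ℕ∞) g V ∧
        ∀ q ∈ V, l q ≠ 0 → g q = H q / l q + Real.sqrt ((H q / l q) ^ 2 - K q / l q))) ↔
    (∃ ε > (0 : ℝ), ∃ V : Set Pt, IsOpen V ∧ p ∈ V ∧ V ⊆ U ∧
      ((∀ q ∈ V, ∀ t ∈ Set.Ioo (0 : ℝ) ε, l q - 2 * t * H q + t ^ 2 * K q ≠ 0) ∨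
       (∀ q ∈ V, ∀ t ∈ Set.Ioo (-ε) (0 : ℝ), l q - 2 * t * H q + t ^ 2 * K q ≠ 0))) := by
  rcases hHp.lt_or_gt with hneg | hpos
  · have h1 := exists_extension_iff_of_pos (l := -l) (H := -H) (K := -K) hU hl.neg hH.neg hK.neg hp (by simp [hlp])
      (neg_pos.2 hneg)
    have h2 := exists_no_root_iff_of_pos (l := -l) (H := -H) (K := -K) hU
      hl.continuousOn.neg hH.continuousOn.neg
      hK.continuousOn.neg hp (by simp [hlp]) (neg_pos.2 hneg)
    have h3 := h1.trans h2.symm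
    have e (q t) : (-l) q - 2 * t * (-H) q + t ^ 2 * (-K) q =
        -(l q - 2 * t * H q + t ^ 2 * K q) := by
      simp only [Pi.neg_apply]
      ring
    simp only [e, neg_ne_zero] at h3
    simpa only [Pi.neg_apply, neg_div_neg_eq, neg_ne_zero] using h3
  · exact (exists_extension_iff_of_pos hU hl hH hK hp hlp hpos).trans
      (exists_no_root_iff_of_pos hU hl.continuousOn hH.continuousOn hK.continuousOn
        hp hlp hpos).symm

end RelativeRoots

section LinearAlgebra

lemma rank_eq_two_iff {m : Type*} [Finite m] (A : Matrix m (Fin 2) ℝ) :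
    A.rank = 2 ↔ ∀ v, A *ᵥ v = 0 → v = 0 := by
  have h := A.mulVecLin.finrank_range_add_finrank_ker
  rw [Module.finrank_fin_fun] at h
  rw [Matrix.rank, ← Matrix.ker_mulVecLin_eq_bot_iff, ← Submodule.finrank_eq_zero (R := ℝ)]
  omega

lemma mulVec_eq_zero_of_cross_ne_zero {A : Matrix (Fin 3) (Fin 2) ℝ}
    (hA : crossProduct (fun i => A i 0) (fun i => A i 1) ≠ 0) (v : Fin 2 → ℝ) :
    A *ᵥ v = 0 ↔ v = 0 := by
  refine ⟨fun h => ?_, fun h => by simp [h]⟩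
  rw [crossProduct_ne_zero_iff_linearIndependent, LinearIndependent.pair_iff] at hA
  have h' := hA (v 0) (v 1) (by
    ext i
    simpa [Matrix.mulVec, dotProduct, Fin.sum_univ_two, mul_comm] using congrFun h i)
  ext i
  fin_cases i
  exacts [h'.1, h'.2]

lemma rank_mul_eq_two_iff {A : Matrix (Fin 3) (Fin 2) ℝ}
    (hA : crossProduct (fun i => A i 0) (fun i => A i 1) ≠ 0) (M : Matrix (Fin 2) (Fin 2) ℝ) :
    (A * M).rank = 2 ↔ M.det ≠ 0 := by
  rw [rank_eq_two_iff, ne_eq, ← Matrix.exists_mulVec_eq_zero_iff]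
  simp only [← Matrix.mulVec_mulVec, mulVec_eq_zero_of_cross_ne_zero hA]
  push Not
  exact forall_congr' fun v => ⟨fun h hv h' => hv (h h'), fun h h' => by_contra fun hv => h hv h'⟩

lemma dotProduct_gram_mulVec {A : Matrix (Fin 3) (Fin 2) ℝ} (v : Fin 2 → ℝ) :
    v ⬝ᵥ (Aᵀ * A) *ᵥ v = A *ᵥ v ⬝ᵥ A *ᵥ v := by
  rw [← Matrix.mulVec_mulVec, Matrix.dotProduct_mulVec, Matrix.vecMul_transpose]

lemma eq_zero_of_dotProduct_gram_mulVec_eq_zero {A : Matrix (Fin 3) (Fin 2) ℝ}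
    (hA : crossProduct (fun i => A i 0) (fun i => A i 1) ≠ 0) {v : Fin 2 → ℝ}
    (h : v ⬝ᵥ (Aᵀ * A) *ᵥ v = 0) : v = 0 := by
  rwa [dotProduct_gram_mulVec, dotProduct_self_eq_zero, mulVec_eq_zero_of_cross_ne_zero hA] at h

lemma det_gram_ne_zero {A : Matrix (Fin 3) (Fin 2) ℝ}
    (hA : crossProduct (fun i => A i 0) (fun i => A i 1) ≠ 0) : (Aᵀ * A).det ≠ 0 := by
  rw [ne_eq, ← Matrix.exists_mulVec_eq_zero_iff]
  rintro ⟨v, hv, h⟩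
  exact hv (eq_zero_of_dotProduct_gram_mulVec_eq_zero hA (by rw [h, dotProduct_zero]))

lemma det_add_smul_fin_two (L M : Matrix (Fin 2) (Fin 2) ℝ) (t : ℝ) :
    (L + t • M).det = L.det - 2 * t * (-(1 / 2) * (M * L.adjugate).trace) + t ^ 2 * M.det := by
  simp [Matrix.det_fin_two, Matrix.adjugate_fin_two, Matrix.trace_fin_two, Matrix.mul_apply,
    Fin.sum_univ_two]
  ring

lemma trace_mul_adjugate_ne_zero {A : Matrix (Fin 3) (Fin 2) ℝ}
    (hA : crossProduct (fun i => A i 0) (fun i => A i 1) ≠ 0) {L M : Matrix (Fin 2) (Fin 2) ℝ}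
    (hdet : L.det = 0) (hL : L ≠ 0) (hsymm : (L * (Aᵀ * A) * Mᵀ).IsSymm)
    (hinj : ∀ v, Lᵀ *ᵥ v = 0 → Mᵀ *ᵥ v = 0 → v = 0) : (M * L.adjugate).trace ≠ 0 := by
  intro htr
  obtain ⟨v, hv, hLv⟩ := Matrix.exists_mulVec_eq_zero_iff.2
    (show Lᵀ.det = 0 by rwa [Matrix.det_transpose])
  have hGy : L *ᵥ ((Aᵀ * A) *ᵥ (Mᵀ *ᵥ v)) = 0 := by
    have h := congrArg (· *ᵥ v) hsymm.eq
    simpa [← Matrix.mulVec_mulVec, Matrix.transpose_mul, hLv] using h.symm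
  obtain ⟨i, hi⟩ : ∃ i, L i ≠ 0 := Function.ne_iff.1 hL
  have h0 := congrFun hLv 0
  have h1 := congrFun hLv 1
  have hpar : (Mᵀ *ᵥ v) 0 * L i 1 = (Mᵀ *ᵥ v) 1 * L i 0 := by
    simp only [Matrix.mulVec, dotProduct, Fin.sum_univ_two, Matrix.transpose_apply,
      Pi.zero_apply] at h0 h1 ⊢
    simp only [Matrix.adjugate_fin_two, Matrix.trace_fin_two, Matrix.mul_apply,
      Fin.sum_univ_two, Matrix.of_apply, Matrix.cons_val_zero, Matrix.cons_val_one] at htr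
    fin_cases i
    · simp only [Fin.zero_eta]
      linear_combination -v 1 * htr + M 0 0 * h1 - M 0 1 * h0
    · simp only [Fin.mk_one]
      linear_combination v 0 * htr + M 1 0 * h1 - M 1 1 * h0
  refine hv (hinj v hLv ?_)
  have hGi : L i ⬝ᵥ (Aᵀ * A) *ᵥ (Mᵀ *ᵥ v) = 0 := congrFun hGy i
  have hne : L i ⬝ᵥ (Aᵀ * A) *ᵥ L i ≠ 0 := fun h =>
    hi (eq_zero_of_dotProduct_gram_mulVec_eq_zero hA h)
  generalize Mᵀ *ᵥ v = y at hGi hpar ⊢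
  have hy : ∀ j, L i j • y = y j • L i := by
    intro j
    ext k
    fin_cases j <;> fin_cases k <;> simp <;> linarith
  ext j
  have := congrArg (fun z => L i ⬝ᵥ (Aᵀ * A) *ᵥ z) (hy j)
  simp only [Matrix.mulVec_smul, dotProduct_smul, hGi, smul_zero] at this
  exact (mul_eq_zero.1 this.symm).resolve_right hne

end LinearAlgebra

namespace Frontal

variable (F : Frontal) {q : Pt}

lemma contDiffOn_cross : ContDiffOn ℝ (⊤ : ℕ∞)
    (fun p => crossProduct (fun i => F.Ω p i 0) (fun i => F.Ω p i 1)) F.U := by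
  have h := F.smooth_Ω
  rw [contDiffOn_pi]
  intro i
  fin_cases i <;> simp only [cross_apply] <;>
    exact ((h _ _).mul (h _ _)).sub ((h _ _).mul (h _ _))

lemma contDiffOn_n : ContDiffOn ℝ (⊤ : ℕ∞) F.n F.U := by
  have hc := F.contDiffOn_cross
  have hd : ContDiffOn ℝ (⊤ : ℕ∞)
      (fun p => crossProduct (fun i => F.Ω p i 0) (fun i => F.Ω p i 1) ⬝ᵥ
        crossProduct (fun i => F.Ω p i 0) (fun i => F.Ω p i 1)) F.U := by
    simp only [dotProduct]
    rw [contDiffOn_pi] at hc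
    exact ContDiffOn.sum fun i _ => (hc i).mul (hc i)
  have hne : ∀ p ∈ F.U, crossProduct (fun i => F.Ω p i 0) (fun i => F.Ω p i 1) ⬝ᵥ
        crossProduct (fun i => F.Ω p i 0) (fun i => F.Ω p i 1) ≠ 0 := fun p hp h =>
    F.indep p hp (dotProduct_self_eq_zero.1 h)
  refine ((hd.sqrt hne).inv fun p hp h => hne p hp ?_).smul hc
  exact (Real.sqrt_eq_zero (Finset.sum_nonneg fun i _ => mul_self_nonneg _)).1 h

lemma differentiableAt_x (hq : q ∈ F.U) : DifferentiableAt ℝ F.x q :=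
  (F.smooth_x.contDiffAt (F.isOpen_U.mem_nhds hq)).differentiableAt (by simp)

lemma differentiableAt_n (hq : q ∈ F.U) : DifferentiableAt ℝ F.n q :=
  (F.contDiffOn_n.contDiffAt (F.isOpen_U.mem_nhds hq)).differentiableAt (by simp)

lemma jac_parallel (hq : q ∈ F.U) (t : ℝ) :
    jac (fun z => F.x z + t • F.n z) q = F.Ω q * (F.Λ q + t • F.μ q)ᵀ := by
  rw [Matrix.transpose_add, Matrix.transpose_smul, Matrix.mul_add, Matrix.mul_smul,
    ← F.decomp_x q hq, ← F.decomp_n q hq]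
  have h : fderiv ℝ (fun z => F.x z + t • F.n z) q = fderiv ℝ F.x q + t • fderiv ℝ F.n q :=
    ((F.differentiableAt_x hq).hasFDerivAt.add
      ((F.differentiableAt_n hq).hasFDerivAt.const_smul t)).fderiv
  rw [jac, h]
  rfl

lemma rank_jac_parallel_eq_two_iff (hq : q ∈ F.U) (t : ℝ) :
    (jac (fun z => F.x z + t • F.n z) q).rank = 2 ↔
      F.lam q - 2 * t * F.HΩ q + t ^ 2 * F.KΩ q ≠ 0 := by
  rw [F.jac_parallel hq, rank_mul_eq_two_iff (F.indep q hq), Matrix.det_transpose,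
    det_add_smul_fin_two]
  rfl

lemma n_dotProduct_fderiv_x (hq : q ∈ F.U) (j : Fin 2) :
    F.n q ⬝ᵥ fderiv ℝ F.x q (Pi.single j 1) = 0 := by
  have h : fderiv ℝ F.x q (Pi.single j 1) = fun i => (F.Ω q * (F.Λ q)ᵀ) i j := by
    ext i
    rw [← F.decomp_x q hq]
    rfl
  rw [h, Frontal.n, normalOf, smul_dotProduct, smul_eq_mul]
  refine mul_eq_zero_of_right _ ?_
  rw [cross_apply, Matrix.vec3_dotProduct]
  simp only [Matrix.cons_val, Matrix.mul_apply, Fin.sum_univ_two, Matrix.transpose_apply]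
  ring

/-- The second fundamental form is symmetric. -/
lemma isSymm_transpose_jac_x_mul_jac_n (hq : q ∈ F.U) :
    ((jac F.x q)ᵀ * jac F.n q).IsSymm := by
  have hx := F.smooth_x.contDiffAt (F.isOpen_U.mem_nhds hq)
  have hd : DifferentiableAt ℝ (fderiv ℝ F.x) q :=
    (hx.fderiv_right (m := 1) (by norm_cast)).differentiableAt (by simp)
  have hsymm : IsSymmSndFDerivAt ℝ F.x q := hx.isSymmSndFDerivAt (by
    rw [minSmoothness_of_isRCLikeNormedField]
    exact WithTop.coe_le_coe.2 (le_top (a := (2 : ℕ∞))))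
  have key : ∀ i j : Fin 2, fderiv ℝ F.n q (Pi.single i 1) ⬝ᵥ fderiv ℝ F.x q (Pi.single j 1) =
      -(F.n q ⬝ᵥ fderiv ℝ (fderiv ℝ F.x) q (Pi.single i 1) (Pi.single j 1)) := by
    intro i j
    have h0 : (fun z => F.n z ⬝ᵥ fderiv ℝ F.x z (Pi.single j 1)) =ᶠ[𝓝 q] fun _ => 0 := by
      filter_upwards [F.isOpen_U.mem_nhds hq] with z hz using F.n_dotProduct_fderiv_x hz j
    have h1 : HasFDerivAt (fun z => F.n z ⬝ᵥ fderiv ℝ F.x z (Pi.single j 1))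
        (∑ k : Fin 3, (F.n q k • (ContinuousLinearMap.proj k ∘L
          (ContinuousLinearMap.apply ℝ (Fin 3 → ℝ) (Pi.single j 1 : Pt)) ∘L
            fderiv ℝ (fderiv ℝ F.x) q) +
          fderiv ℝ F.x q (Pi.single j 1) k • (ContinuousLinearMap.proj k ∘L fderiv ℝ F.n q))) q := by
      simp only [dotProduct]
      refine HasFDerivAt.fun_sum fun k _ => HasFDerivAt.mul ?_ ?_
      · exact (hasFDerivAt_apply k _).comp q (F.differentiableAt_n hq).hasFDerivAt
      · exact (hasFDerivAt_apply k _).comp q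
          ((ContinuousLinearMap.apply ℝ (Fin 3 → ℝ) (Pi.single j 1 : Pt)).hasFDerivAt.comp q
            hd.hasFDerivAt)
    have h2 := congrArg (· (Pi.single i 1))
      (h1.unique ((hasFDerivAt_const (0 : ℝ) q).congr_of_eventuallyEq h0))
    simp [Finset.sum_add_distrib] at h2
    simp only [dotProduct]
    rw [eq_neg_iff_add_eq_zero, add_comm, ← h2]
    simp [mul_comm]
  rw [Matrix.IsSymm, Matrix.transpose_mul, Matrix.transpose_transpose]
  ext i j
  have h := (key i j).trans ((congrArg (fun z => -(F.n q ⬝ᵥ z)) (hsymm _ _)).trans (key j i).symm)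
  rw [dotProduct_comm (fderiv ℝ F.n q (Pi.single j 1))] at h
  exact h

lemma HΩ_ne_zero (hW : F.IsWavefront) (hq : q ∈ F.sing) (hr : (jac F.x q).rank = 1) :
    F.HΩ q ≠ 0 := by
  obtain ⟨hqU, hlam⟩ := hq
  refine mul_ne_zero (by norm_num) (trace_mul_adjugate_ne_zero (F.indep q hqU) hlam ?_ ?_ ?_)
  · intro h
    rw [F.decomp_x q hqU, h] at hr
    simp at hr
  · have h := F.isSymm_transpose_jac_x_mul_jac_n hqU
    rw [F.decomp_x q hqU, Frontal.n, F.decomp_n q hqU, Matrix.transpose_mul,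
      Matrix.transpose_transpose] at h
    simpa only [Matrix.mul_assoc] using h
  · intro v h1 h2
    refine (rank_eq_two_iff _).1 (hW q hqU) v ?_
    rw [Matrix.fromRows_mulVec, F.decomp_x q hqU, Frontal.n, F.decomp_n q hqU,
      ← Matrix.mulVec_mulVec, ← Matrix.mulVec_mulVec, h1, h2]
    ext (i | i) <;> simp

lemma Kg_eq (hq : q ∈ F.reg) : F.Kg q = F.KΩ q / F.lam q := by
  obtain ⟨hqU, hlam⟩ := hq
  have hG := det_gram_ne_zero (F.indep q hqU)
  have h1 : (IIOf F.x F.n q).det = F.lam q * ((F.Ω q)ᵀ * F.Ω q).det * F.KΩ q := by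
    rw [IIOf, F.decomp_x q hqU, Frontal.n, F.decomp_n q hqU, Matrix.transpose_mul,
      Matrix.transpose_transpose, Matrix.mul_assoc, ← Matrix.mul_assoc (F.Ω q)ᵀ,
      Matrix.det_neg, Matrix.det_mul, Matrix.det_mul, Matrix.det_transpose]
    simp [lam, KΩ, mul_assoc]
  have h2 : (IOf F.x q).det = F.lam q * ((F.Ω q)ᵀ * F.Ω q).det * F.lam q := by
    rw [IOf, F.decomp_x q hqU, Matrix.transpose_mul,
      Matrix.transpose_transpose, Matrix.mul_assoc, ← Matrix.mul_assoc (F.Ω q)ᵀ,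
      Matrix.det_mul, Matrix.det_mul, Matrix.det_transpose]
    simp [lam, mul_assoc]
  rw [Kg, KgOf, h1, h2]
  field_simp

lemma Wein_eq (hq : q ∈ F.reg) : F.Wein q = F.μ q * (F.Λ q)⁻¹ := by
  obtain ⟨hqU, hlam⟩ := hq
  have hG : IsUnit ((F.Ω q)ᵀ * F.Ω q).det := (det_gram_ne_zero (F.indep q hqU)).isUnit
  have hL : IsUnit (F.Λ q)ᵀ.det := by
    rw [Matrix.det_transpose]
    exact Ne.isUnit hlam
  have hI : IOf F.x q = F.Λ q * (((F.Ω q)ᵀ * F.Ω q) * (F.Λ q)ᵀ) := by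
    rw [IOf, F.decomp_x q hqU, Matrix.transpose_mul, Matrix.transpose_transpose]
    simp only [Matrix.mul_assoc]
  have hII : (IIOf F.x F.n q)ᵀ = -(F.μ q * (((F.Ω q)ᵀ * F.Ω q) * (F.Λ q)ᵀ)) := by
    rw [IIOf, F.decomp_x q hqU, Frontal.n, F.decomp_n q hqU]
    simp only [Matrix.transpose_neg, Matrix.transpose_mul, Matrix.transpose_transpose,
      Matrix.mul_assoc]
  have hGL : IsUnit (((F.Ω q)ᵀ * F.Ω q) * (F.Λ q)ᵀ).det := by
    rw [Matrix.det_mul]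
    exact hG.mul hL
  rw [Wein, weinOf, hI, hII, Matrix.mul_inv_rev, neg_mul, neg_neg, Matrix.mul_assoc,
    Matrix.mul_nonsing_inv_cancel_left _ _ hGL]

lemma Hm_eq (hq : q ∈ F.reg) : F.Hm q = F.HΩ q / F.lam q := by
  change -(1 / 2) * (F.Wein q).trace = _
  rw [F.Wein_eq hq, Matrix.inv_def, Ring.inverse_eq_inv', Matrix.mul_smul, Matrix.trace_smul,
    HΩ, αΩ, lam, smul_eq_mul]
  ring

lemma contDiffOn_lam : ContDiffOn ℝ (⊤ : ℕ∞) F.lam F.U := by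
  have h := F.smooth_Λ
  refine ContDiffOn.congr (((h 0 0).mul (h 1 1)).sub ((h 0 1).mul (h 1 0))) fun p _ => ?_
  rw [lam, Matrix.det_fin_two]

lemma contDiffOn_KΩ : ContDiffOn ℝ (⊤ : ℕ∞) F.KΩ F.U := by
  have h := F.smooth_μ
  refine ContDiffOn.congr (((h 0 0).mul (h 1 1)).sub ((h 0 1).mul (h 1 0))) fun p _ => ?_
  rw [KΩ, Matrix.det_fin_two]

lemma contDiffOn_HΩ : ContDiffOn ℝ (⊤ : ℕ∞) F.HΩ F.U := by
  have h := F.smooth_μ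
  have h' := F.smooth_Λ
  refine ContDiffOn.congr (contDiffOn_const (c := (-(1 / 2) : ℝ)).mul
    ((((h 0 0).mul (h' 1 1)).sub ((h 0 1).mul (h' 1 0))).add
      (((h 1 1).mul (h' 0 0)).sub ((h 1 0).mul (h' 0 1))))) fun p _ => ?_
  simp [HΩ, αΩ, Matrix.adjugate_fin_two, Matrix.trace_fin_two, Matrix.mul_apply,
    Fin.sum_univ_two]
  ring

lemma smoothExtNear_iff {f g : Pt → ℝ} {p : Pt} (h : ∀ q ∈ F.reg, f q = g q) :
    F.SmoothExtNear f p ↔ ∃ V : Set Pt, IsOpen V ∧ p ∈ V ∧ V ⊆ F.U ∧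
      ∃ φ : Pt → ℝ, ContDiffOn ℝ (⊤ : ℕ∞) φ V ∧ ∀ q ∈ V, F.lam q ≠ 0 → φ q = g q := by
  refine exists_congr fun V => and_congr_right fun _ => and_congr_right fun _ =>
    and_congr_right fun hVU => exists_congr fun φ => and_congr_right fun _ => ?_
  exact ⟨fun hφ q hq hl => (hφ q ⟨hq, hVU hq, hl⟩).trans (h q ⟨hVU hq, hl⟩),
    fun hφ q hq => (hφ q hq.1 hq.2.2).trans (h q hq.2).symm⟩

lemma parSmoothable_iff (p : Pt) :
    F.ParSmoothable p ↔ ∃ ε > (0 : ℝ), ∃ V : Set Pt, IsOpen V ∧ p ∈ V ∧ V ⊆ F.U ∧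
      ((∀ q ∈ V, ∀ t ∈ Set.Ioo (0 : ℝ) ε, F.lam q - 2 * t * F.HΩ q + t ^ 2 * F.KΩ q ≠ 0) ∨
       (∀ q ∈ V, ∀ t ∈ Set.Ioo (-ε) (0 : ℝ),
          F.lam q - 2 * t * F.HΩ q + t ^ 2 * F.KΩ q ≠ 0)) := by
  refine exists_congr fun ε => and_congr_right fun _ => exists_congr fun V =>
    and_congr_right fun _ => and_congr_right fun _ => and_congr_right fun hVU => or_congr ?_ ?_ <;>
  exact forall₂_congr fun q hq => forall₂_congr fun t _ =>
    F.rank_jac_parallel_eq_two_iff (hVU hq) t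

end Frontal

/-- at a rank-1 singularity of a wavefront, one of the principal
curvatures `κ₋`, `κ₊` admits a `C^∞` extension to an open neighborhood of `p`
iff `x` is parallelly smoothable at `p`. -/
theorem stmt17 (F : Frontal) (hW : F.IsWavefront)
    (p : Pt) (hp : p ∈ F.sing) (hr : (jac F.x p).rank = 1) :
    (F.SmoothExtNear F.κm p ∨ F.SmoothExtNear F.κp p) ↔ F.ParSmoothable p := by
  rw [F.parSmoothable_iff,
    F.smoothExtNear_iff (f := F.κm) (g := fun q => F.HΩ q / F.lam q -
      Real.sqrt ((F.HΩ q / F.lam q) ^ 2 - F.KΩ q / F.lam q))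
      (fun q hq => by rw [Frontal.κm, F.Hm_eq hq, F.Kg_eq hq]),
    F.smoothExtNear_iff (f := F.κp) (g := fun q => F.HΩ q / F.lam q +
      Real.sqrt ((F.HΩ q / F.lam q) ^ 2 - F.KΩ q / F.lam q))
      (fun q hq => by rw [Frontal.κp, F.Hm_eq hq, F.Kg_eq hq])]
  exact exists_extension_iff_exists_no_root F.isOpen_U F.contDiffOn_lam F.contDiffOn_HΩ
    F.contDiffOn_KΩ hp.1 hp.2 (F.HΩ_ne_zero hW hp hr)
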